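/- Let g be a continuous real function on S_L and let α ∈ ℝ. Then Σ_{j=1}^k w_j Φ(f(A_j)) ≥ α·g(B_L) + ( min_{x ∈ S_L} (x − α·g(x)) )·1_K in the Loewner order, where 1_K is the identity operator on K. -/

import Mathlib

open ContinuousLinearMap in
/-- The Kantorovich constant `K(m', M', r)`, with the convention that it equals `1`
for `r = 0` and `r = 1`. -/
noncomputable def kantorovich (m M r : ℝ) : ℝ :=
  if r = 0 ∨ r = 1 then 1 else
    ((m * M ^ r - M * m ^ r) / ((r - 1) * (M - m))) *
      (((r - 1) * (M ^ r - m ^ r)) / (r * (m * M ^ r - M * m ^ r))) ^ r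

open ContinuousLinearMap Polynomial

/-- The Kantorovich constant of a natural exponent is at least `1`. -/
lemma one_le_kantorovich_natCast {m M : ℝ} (hm : 0 < m) (hmM : m < M) (n : ℕ) :
    1 ≤ kantorovich m M n := by
  unfold kantorovich
  split_ifs with h
  · exact le_rfl
  push Not at h
  have hn0 : n ≠ 0 := by exact_mod_cast h.1
  have hn1 : n ≠ 1 := by exact_mod_cast h.2
  have hn : 1 < n := by omega
  have hnR : (1 : ℝ) < n := by exact_mod_cast hn
  have hM : 0 < M := hm.trans hmM
  simp only [Real.rpow_natCast]
  have hs : 0 < M ^ n - m ^ n := sub_pos.2 (pow_lt_pow_left₀ hmM hm.le hn0)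
  have hc : 0 < m * M ^ n - M * m ^ n := by
    obtain ⟨l, rfl⟩ : ∃ l, n = l + 1 := ⟨n - 1, by omega⟩
    have : m ^ l < M ^ l := pow_lt_pow_left₀ hmM hm.le (by omega)
    have h2 := mul_pos (mul_pos hm hM) (sub_pos.2 this)
    rw [pow_succ, pow_succ]
    linarith
  have hd : 0 < M - m := sub_pos.2 hmM
  have hn' : (0 : ℝ) < n - 1 := sub_pos.2 hnR
  have hn'' : (0 : ℝ) < n := by linarith
  set s := M ^ n - m ^ n with hs_def
  set c := m * M ^ n - M * m ^ n with hc_def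
  set t := ((n - 1) * s) / (n * c) with ht_def
  have ht : 0 < t := by positivity
  have hbern : 1 + n * (m * t - 1) ≤ (1 + (m * t - 1)) ^ n :=
    one_add_mul_le_pow (by nlinarith [mul_pos hm ht]) n
  have hchord : c / ((n - 1) * (M - m)) * (1 + n * (m * t - 1)) = m ^ n := by
    rw [ht_def]
    field_simp
    rw [hs_def, hc_def]
    ring
  have hle : m ^ n ≤ c / ((n - 1) * (M - m)) * t ^ n * m ^ n := by
    calc m ^ n = c / ((n - 1) * (M - m)) * (1 + n * (m * t - 1)) := hchord.symm
      _ ≤ c / ((n - 1) * (M - m)) * (1 + (m * t - 1)) ^ n := by gcongr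
      _ = _ := by rw [add_sub_cancel, mul_pow]; ring
  exact (le_mul_iff_one_le_left (pow_pos hm n)).1 hle

/-- The infimum over a compact interval of a polynomial that is positive there is positive. -/
lemma Polynomial.sInf_image_Icc_pos (p : Polynomial ℝ) {a b : ℝ} (hab : a ≤ b)
    (hp : ∀ x ∈ Set.Icc a b, 0 < p.eval x) :
    0 < sInf ((fun x => p.eval x) '' Set.Icc a b) := by
  obtain ⟨x, hx, hx'⟩ := (isCompact_Icc.image p.continuous).sInf_mem
    ((Set.nonempty_Icc.2 hab).image _)
  exact hx' ▸ hp x hx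

/-- Termwise comparison of a polynomial expression with the one built from bounds `l ≤ y ≤ u`,
weighted with constants at least `1`. -/
lemma sum_filter_bounds_le (s : Finset ℕ) (a κ ν : ℕ → ℝ) {l y u : ℝ} (hl : 0 ≤ l) (hly : l ≤ y)
    (hyu : y ≤ u) (hκ : ∀ i, 1 ≤ κ i) (hν : ∀ i, 1 ≤ ν i) :
    (∑ i ∈ s.filter (fun i => 0 ≤ a i), a i * (κ i)⁻¹ * l ^ i) +
      ∑ i ∈ s.filter (fun i => a i < 0), a i * ν i * u ^ i ≤ ∑ i ∈ s, a i * y ^ i := by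
  rw [← Finset.sum_filter_add_sum_filter_not s (fun i => 0 ≤ a i) (fun i => a i * y ^ i)]
  simp only [not_le]
  refine add_le_add (Finset.sum_le_sum fun i hi => ?_) (Finset.sum_le_sum fun i hi => ?_)
  · rw [mul_assoc]
    refine mul_le_mul_of_nonneg_left ?_ (Finset.mem_filter.1 hi).2
    calc (κ i)⁻¹ * l ^ i ≤ 1 * l ^ i :=
          mul_le_mul_of_nonneg_right (inv_le_one_of_one_le₀ (hκ i)) (pow_nonneg hl i)
      _ ≤ y ^ i := by rw [one_mul]; exact pow_le_pow_left₀ hl hly i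
  · rw [mul_assoc]
    refine mul_le_mul_of_nonpos_left ?_ (Finset.mem_filter.1 hi).2.le
    calc y ^ i ≤ 1 * u ^ i := by rw [one_mul]; exact pow_le_pow_left₀ (hl.trans hly) hyu i
      _ ≤ ν i * u ^ i :=
          mul_le_mul_of_nonneg_right (hν i) (pow_nonneg (hl.trans (hly.trans hyu)) i)

section Hilbert

variable {H K : Type*} [NormedAddCommGroup H] [InnerProductSpace ℂ H] [CompleteSpace H]
  [NormedAddCommGroup K] [InnerProductSpace ℂ K] [CompleteSpace K]

lemma ContinuousLinearMap.adjoint_conj_mono (V : K →L[ℂ] H) {P Q : H →L[ℂ] H} (h : P ≤ Q) :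
    (adjoint V) ∘L P ∘L V ≤ (adjoint V) ∘L Q ∘L V := by
  rw [ContinuousLinearMap.le_def] at h ⊢
  have := h.adjoint_conj V
  rwa [sub_comp, comp_sub] at this

lemma ContinuousLinearMap.sum_smul_adjoint_conj_mono {ι : Type*} [Fintype ι] (V : K →L[ℂ] H)
    {w : ι → ℝ} (hw : ∀ j, 0 ≤ w j) {P Q : ι → H →L[ℂ] H} (h : ∀ j, P j ≤ Q j) :
    ∑ j, w j • ((adjoint V) ∘L P j ∘L V) ≤ ∑ j, w j • ((adjoint V) ∘L Q j ∘L V) :=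
  Finset.sum_le_sum fun j _ =>
    smul_le_smul_of_nonneg_left (adjoint_conj_mono V (h j)) (hw j)

lemma ContinuousLinearMap.sum_smul_adjoint_conj_algebraMap {ι : Type*} [Fintype ι]
    {V : K →L[ℂ] H} (hV : (adjoint V) ∘L V = 1) {w : ι → ℝ} (hw1 : ∑ j, w j = 1) (r : ℝ) :
    ∑ j, w j • ((adjoint V) ∘L (algebraMap ℝ (H →L[ℂ] H) r) ∘L V) =
      algebraMap ℝ (K →L[ℂ] K) r := by
  have : (adjoint V) ∘L (algebraMap ℝ (H →L[ℂ] H) r) ∘L V = algebraMap ℝ (K →L[ℂ] K) r := by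
    rw [Algebra.algebraMap_eq_smul_one, Algebra.algebraMap_eq_smul_one, smul_comp, comp_smul,
      one_def, id_comp, hV]
  rw [this, ← Finset.sum_smul, hw1, one_smul]

/-- A convex combination of compressions of self-adjoint operators whose spectra lie in a compact
convex set of reals has its spectrum in that set. -/
lemma ContinuousLinearMap.spectrum_sum_smul_adjoint_conj_subset {ι : Type*} [Fintype ι]
    {V : K →L[ℂ] H} (hV : (adjoint V) ∘L V = 1) {w : ι → ℝ} (hw : ∀ j, 0 ≤ w j)
    (hw1 : ∑ j, w j = 1) {P : ι → H →L[ℂ] H} (hP : ∀ j, IsSelfAdjoint (P j)) {S : Set ℝ}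
    (hS : IsCompact S) (hS' : Convex ℝ S) (hne : S.Nonempty) (hPS : ∀ j, spectrum ℝ (P j) ⊆ S) :
    IsSelfAdjoint (∑ j, w j • ((adjoint V) ∘L P j ∘L V)) ∧
      spectrum ℝ (∑ j, w j • ((adjoint V) ∘L P j ∘L V)) ⊆ S := by
  have hsa : IsSelfAdjoint (∑ j, w j • ((adjoint V) ∘L P j ∘L V)) :=
    isSelfAdjoint_sum _ fun j _ => (IsSelfAdjoint.all (w j)).smul ((hP j).adjoint_conj V)
  refine ⟨hsa, fun x hx => hS'.ordConnected.out (hS.sInf_mem hne) (hS.sSup_mem hne) ⟨?_, ?_⟩⟩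
  · refine (algebraMap_le_iff_le_spectrum hsa).1 ?_ x hx
    rw [← sum_smul_adjoint_conj_algebraMap hV hw1]
    exact sum_smul_adjoint_conj_mono V hw fun j => (algebraMap_le_iff_le_spectrum (hP j)).2
      fun y hy => csInf_le hS.bddBelow (hPS j hy)
  · refine (le_algebraMap_iff_spectrum_le hsa).1 ?_ x hx
    rw [← sum_smul_adjoint_conj_algebraMap hV hw1]
    exact sum_smul_adjoint_conj_mono V hw fun j => (le_algebraMap_iff_spectrum_le (hP j)).2
      fun y hy => le_csSup hS.bddAbove (hPS j hy)

/-- The infimum of `x - α g(x)` over a compact set containing the spectrum of `B` bounds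
`B - α g(B)` from below. -/
lemma ContinuousLinearMap.smul_cfc_add_sInf_smul_one_le {B : K →L[ℂ] K} (hB : IsSelfAdjoint B)
    {S : Set ℝ} (hS : IsCompact S) (hBS : spectrum ℝ B ⊆ S) {g : ℝ → ℝ} (hg : ContinuousOn g S)
    (α : ℝ) :
    α • cfc g B + (sInf ((fun x => x - α * g x) '' S)) • (1 : K →L[ℂ] K) ≤ B := by
  have hcont : ContinuousOn (fun x => x - α * g x) S :=
    continuousOn_id.sub (continuousOn_const.mul hg)
  have hgB : ContinuousOn g (spectrum ℝ B) := hg.mono hBS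
  have h : algebraMap ℝ (K →L[ℂ] K) (sInf ((fun x => x - α * g x) '' S)) ≤
      cfc (fun x => x - α * g x) B :=
    algebraMap_le_cfc _ _ _
      (fun x hx => csInf_le (hS.image_of_continuousOn hcont).bddBelow ⟨x, hBS hx, rfl⟩)
      (hcont.mono hBS)
  rw [cfc_sub (fun x => x) (fun x => α * g x) B continuousOn_id (continuousOn_const.mul hgB),
    cfc_id' ℝ B, cfc_const_mul α g B hgB, Algebra.algebraMap_eq_smul_one] at h
  exact le_sub_iff_add_le'.1 h

lemma ContinuousLinearMap.sum_smul_cfc_pow {A : H →L[ℂ] H} (hA : IsSelfAdjoint A) {f : ℝ → ℝ}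
    (hf : ContinuousOn f (spectrum ℝ A)) (a : ℕ → ℝ) (s : Finset ℕ) :
    ∑ i ∈ s, a i • (cfc f A) ^ i = cfc (fun x => ∑ i ∈ s, a i * f x ^ i) A := by
  have hsum : (fun x => ∑ i ∈ s, a i * f x ^ i) = ∑ i ∈ s, fun x => a i * f x ^ i := by
    ext x
    simp
  rw [hsum, cfc_sum (fun i x => a i * f x ^ i) A s fun i _ => continuousOn_const.mul (hf.pow i)]
  refine Finset.sum_congr rfl fun i _ => ?_
  rw [cfc_const_mul (a i) (fun x => f x ^ i) A (hf.pow i), cfc_pow f i A hf hA]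

end Hilbert

theorem stmt3
    {H K : Type*} [NormedAddCommGroup H] [InnerProductSpace ℂ H] [CompleteSpace H]
    [NormedAddCommGroup K] [InnerProductSpace ℂ K] [CompleteSpace K]
    (V : K →L[ℂ] H) (hV : (adjoint V) ∘L V = 1)
    (I : ℕ) (a : ℕ → ℝ)
    (k : ℕ) (hk : 1 ≤ k)
    (w : Fin k → ℝ) (hw : ∀ j, 0 ≤ w j) (hw1 : ∑ j, w j = 1)
    (m M : Fin k → ℝ) (hmM : ∀ j, m j < M j)
    (A : Fin k → H →L[ℂ] H) (hA : ∀ j, IsSelfAdjoint (A j))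
    (hspec : ∀ j, spectrum ℝ (A j) ⊆ Set.Icc (m j) (M j))
    (f : ℝ → ℝ) (hf : ContinuousOn f (⋃ j, Set.Icc (m j) (M j)))
    (pL pU : Polynomial ℝ)
    (hp : ∀ x ∈ ⋃ j, Set.Icc (m j) (M j),
      0 < pL.eval x ∧ pL.eval x ≤ f x ∧ f x ≤ pU.eval x)
    (mU MU mL ML : Fin k → ℝ)
    (hmU : ∀ j, mU j = sInf ((fun x => pU.eval x) '' Set.Icc (m j) (M j)))
    (hMU : ∀ j, MU j = sSup ((fun x => pU.eval x) '' Set.Icc (m j) (M j)))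
    (hmL : ∀ j, mL j = sInf ((fun x => pL.eval x) '' Set.Icc (m j) (M j)))
    (hML : ∀ j, ML j = sSup ((fun x => pL.eval x) '' Set.Icc (m j) (M j)))
    (hUlt : ∀ j, mU j < MU j) (hLlt : ∀ j, mL j < ML j)
    (qU qL : Fin k → ℝ → ℝ)
    (hqU : ∀ j x, qU j x =
      (∑ i ∈ (Finset.range (I + 1)).filter (fun i => 0 ≤ a i),
        a i * kantorovich (mU j) (MU j) (i : ℝ) * (pU.eval x) ^ i) +
      ∑ i ∈ (Finset.range (I + 1)).filter (fun i => a i < 0),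
        a i * (kantorovich (mL j) (ML j) (i : ℝ))⁻¹ * (pL.eval x) ^ i)
    (hqL : ∀ j x, qL j x =
      (∑ i ∈ (Finset.range (I + 1)).filter (fun i => 0 ≤ a i),
        a i * (kantorovich (mL j) (ML j) (i : ℝ))⁻¹ * (pL.eval x) ^ i) +
      ∑ i ∈ (Finset.range (I + 1)).filter (fun i => a i < 0),
        a i * kantorovich (mU j) (MU j) (i : ℝ) * (pU.eval x) ^ i)
    (BU BL : K →L[ℂ] K)
    (hBU : BU = ∑ j, w j • ((adjoint V) ∘L (cfc (qU j) (A j)) ∘L V))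
    (hBL : BL = ∑ j, w j • ((adjoint V) ∘L (cfc (qL j) (A j)) ∘L V))
    (SU SL : Set ℝ)
    (hSU : SU = closure (convexHull ℝ (⋃ j, qU j '' Set.Icc (m j) (M j))))
    (hSL : SL = closure (convexHull ℝ (⋃ j, qL j '' Set.Icc (m j) (M j))))
    (g : ℝ → ℝ) (hg : ContinuousOn g SL) (α : ℝ) :
    α • cfc g BL + (sInf ((fun x => x - α * g x) '' SL)) • (1 : K →L[ℂ] K) ≤
      (∑ j, w j • ((adjoint V) ∘L (∑ i ∈ Finset.range (I + 1), a i • (cfc f (A j)) ^ i) ∘L V)) := by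
  have hcover : ∀ j, Set.Icc (m j) (M j) ⊆ ⋃ j, Set.Icc (m j) (M j) := fun j =>
    Set.subset_iUnion (fun j => Set.Icc (m j) (M j)) j
  have hqLcont : ∀ j, Continuous (qL j) := fun j => by
    rw [funext (hqL j)]
    fun_prop
  have hmLpos : ∀ j, 0 < mL j := fun j => hmL j ▸
    pL.sInf_image_Icc_pos (hmM j).le fun x hx => (hp x (hcover j hx)).1
  have hmUpos : ∀ j, 0 < mU j := fun j => hmU j ▸
    pU.sInf_image_Icc_pos (hmM j).le fun x hx =>
      have h := hp x (hcover j hx)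
      h.1.trans_le (h.2.1.trans h.2.2)
  have hcpt : IsCompact SL := by
    rw [hSL]
    exact ((isBounded_convexHull.2 (isCompact_iUnion fun j =>
      isCompact_Icc.image (hqLcont j)).isBounded)).isCompact_closure
  have hmem : ∀ j, ∀ x ∈ Set.Icc (m j) (M j), qL j x ∈ SL := fun j x hx => by
    rw [hSL]
    exact subset_closure (subset_convexHull ℝ _ (Set.mem_iUnion.2 ⟨j, x, hx, rfl⟩))
  have hconv : Convex ℝ SL := hSL ▸ (convex_convexHull ℝ _).closure
  have hne : SL.Nonempty := ⟨_, hmem ⟨0, hk⟩ _ (Set.left_mem_Icc.2 (hmM _).le)⟩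
  obtain ⟨hBsa, hBspec⟩ := spectrum_sum_smul_adjoint_conj_subset hV hw hw1
    (P := fun j => cfc (qL j) (A j)) (fun j => cfc_predicate _ _) hcpt hconv hne fun j => by
      rw [cfc_map_spectrum (qL j) (A j) (hA j) (hqLcont j).continuousOn]
      rintro _ ⟨x, hx, rfl⟩
      exact hmem j x (hspec j hx)
  rw [← hBL] at hBsa hBspec
  refine (smul_cfc_add_sInf_smul_one_le hBsa hcpt hBspec hg α).trans ?_
  rw [hBL]
  refine sum_smul_adjoint_conj_mono V hw fun j => ?_
  have hfj : ContinuousOn f (spectrum ℝ (A j)) := hf.mono ((hspec j).trans (hcover j))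
  rw [sum_smul_cfc_pow (hA j) hfj]
  refine cfc_mono (fun x hx => ?_) (hqLcont j).continuousOn
    (continuousOn_finsetSum _ fun i _ => continuousOn_const.mul (hfj.pow i))
  obtain ⟨h0, h1, h2⟩ := hp x (hcover j (hspec j hx))
  rw [hqL]
  exact sum_filter_bounds_le _ a (fun i => kantorovich (mL j) (ML j) i)
    (fun i => kantorovich (mU j) (MU j) i) h0.le h1 h2
    (one_le_kantorovich_natCast (hmLpos j) (hLlt j)) (one_le_kantorovich_natCast (hmUpos j) (hUlt j))
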